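/- Let Λ be the r×r diagonal matrix with diagonal entries Λ_{k,k} = Ω^{k−1} for k = 1,…,r. Then (D⁺)⁻¹ · (U⁻)ᵀ · (−exp(πi/r)·Λ) · U⁻ · D⁻ = K, where K is the r×r matrix with K_{2j−1,2j} = 1 and K_{2j,2j−1} = −1 for every integer j with 1 ≤ j ≤ ⌊r/2⌋, with K_{r,r} = 1 if r is odd, and with all other entries equal to 0. (This is the lower-right r×r block of the jump matrix of the Riemann–Hilbert problem for X on the negative real axis.) -/

import Mathlib

open Matrix Complex

/-- `Ω = exp(2πi/r)`. -/
noncomputable def Omega (r : ℕ) : ℂ := Complex.exp (2 * Real.pi * Complex.I / r)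

/-- The `r × r` matrix `U⁺` with (1-based) entries
`U⁺_{i,c} = r^{-1/2}·Ω^{(i−1)·(c/2)}` for even `c`, and
`U⁺_{i,c} = r^{-1/2}·Ω^{−(i−1)·((c−1)/2)}` for odd `c`. -/
noncomputable def Uplus (r : ℕ) : Matrix (Fin r) (Fin r) ℂ := fun i c =>
  (1 / Real.sqrt r) *
    (if (c.val + 1) % 2 = 0
      then Omega r ^ ((i.val : ℤ) * (((c.val + 1) / 2 : ℕ) : ℤ))
      else Omega r ^ (-((i.val : ℤ) * ((c.val / 2 : ℕ) : ℤ))))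

/-- `U⁻` is the entrywise complex conjugate of `U⁺`. -/
noncomputable def Uminus (r : ℕ) : Matrix (Fin r) (Fin r) ℂ :=
  (Uplus r).map (starRingEnd ℂ)

/-- Diagonal entry of `D⁺` at the (zero-based) index `k`. -/
noncomputable def DplusEntry (r k : ℕ) : ℂ :=
  if k = 0 then 1
  else if k % 2 = 1 then
    (-1 : ℂ) ^ ((k + 1) / 2 - 1) *
      Complex.exp (Real.pi * Complex.I * (((k + 1) / 2 : ℕ) : ℂ) / r)
  else
    (-1 : ℂ) ^ (k / 2) *
      Complex.exp (-(Real.pi * Complex.I * ((k / 2 : ℕ) : ℂ) / r))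

/-- Diagonal entry of `D⁻` at the (zero-based) index `k`. -/
noncomputable def DminusEntry (r k : ℕ) : ℂ :=
  if k = 0 then 1
  else if k % 2 = 1 then
    (-1 : ℂ) ^ ((k + 1) / 2) *
      Complex.exp (-(Real.pi * Complex.I * (((k + 1) / 2 : ℕ) : ℂ) / r))
  else
    (-1 : ℂ) ^ (k / 2) *
      Complex.exp (Real.pi * Complex.I * ((k / 2 : ℕ) : ℂ) / r)

noncomputable def Dplus (r : ℕ) : Matrix (Fin r) (Fin r) ℂ :=
  Matrix.diagonal fun k => DplusEntry r k.val

noncomputable def Dminus (r : ℕ) : Matrix (Fin r) (Fin r) ℂ :=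
  Matrix.diagonal fun k => DminusEntry r k.val

/-- The diagonal matrix `Λ` with `Λ_{k,k} = Ω^{k−1}` (1-based indexing). -/
noncomputable def Lambda (r : ℕ) : Matrix (Fin r) (Fin r) ℂ :=
  Matrix.diagonal fun k => Omega r ^ k.val

/-- The matrix `K` (1-based indexing): `K_{2j−1,2j} = 1` and `K_{2j,2j−1} = −1`
for `1 ≤ j ≤ ⌊r/2⌋`, `K_{r,r} = 1` if `r` is odd, all other entries `0`. -/
noncomputable def Kmat (r : ℕ) : Matrix (Fin r) (Fin r) ℂ := fun a b =>
  if r % 2 = 1 ∧ a.val = r - 1 ∧ b.val = r - 1 then 1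
  else if a.val % 2 = 0 ∧ b.val = a.val + 1 then 1
  else if a.val % 2 = 1 ∧ b.val + 1 = a.val then -1
  else 0

/-- The exponent `m` with `U⁻_{i,k} = r^{-1/2}·Ω^{i·m}`, for zero-based indices `i` and `k`. -/
def colExp (k : ℕ) : ℤ :=
  if k % 2 = 1 then -(((k + 1) / 2 : ℕ) : ℤ) else ((k / 2 : ℕ) : ℤ)

/-- The square root `exp(πi/r)` of `Ω`. -/
noncomputable def halfOmega (r : ℕ) : ℂ := Complex.exp (Real.pi * Complex.I / r)

lemma halfOmega_ne_zero (r : ℕ) : halfOmega r ≠ 0 := Complex.exp_ne_zero _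

lemma halfOmega_pow_self {r : ℕ} (hr : 0 < r) : halfOmega r ^ r = -1 := by
  have : (r : ℂ) ≠ 0 := by exact_mod_cast hr.ne'
  rw [halfOmega, ← Complex.exp_nat_mul, mul_div_cancel₀ _ this, Complex.exp_pi_mul_I]

lemma exp_pi_mul_I_mul_div (r j : ℕ) :
    Complex.exp (Real.pi * Complex.I * (j : ℂ) / r) = halfOmega r ^ j := by
  rw [halfOmega, ← Complex.exp_nat_mul]
  congr 1
  ring

lemma Omega_ne_zero (r : ℕ) : Omega r ≠ 0 := Complex.exp_ne_zero _

lemma isPrimitiveRoot_Omega {r : ℕ} (hr : 0 < r) : IsPrimitiveRoot (Omega r) r :=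
  Complex.isPrimitiveRoot_exp r hr.ne'

lemma conj_Omega (r : ℕ) : (starRingEnd ℂ) (Omega r) = (Omega r)⁻¹ := by
  rw [Omega, ← Complex.exp_conj, ← Complex.exp_neg]
  congr 1
  simp [neg_div, Complex.conj_ofNat]

lemma Uminus_apply (r : ℕ) (i k : Fin r) :
    Uminus r i k = (1 / Real.sqrt r) * Omega r ^ ((i.val : ℤ) * colExp k.val) := by
  have hk : (k.val + 1) % 2 = 0 ↔ k.val % 2 = 1 := by omega
  simp only [Uminus, Uplus, Matrix.map_apply, colExp, hk]
  split_ifs <;> simp [map_zpow₀, conj_Omega]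

lemma DminusEntry_eq (r k : ℕ) : DminusEntry r k = (-halfOmega r) ^ colExp k := by
  rw [DminusEntry, colExp]
  split_ifs with h0 h1 h1
  · omega
  · simp [h0]
  · rw [Complex.exp_neg, exp_pi_mul_I_mul_div, _root_.zpow_neg, zpow_natCast,
      neg_pow (halfOmega r), mul_inv, ← inv_pow (-1 : ℂ)]
    norm_num
  · rw [exp_pi_mul_I_mul_div, zpow_natCast, neg_pow (halfOmega r)]

lemma DplusEntry_eq (r k : ℕ) :
    DplusEntry r k = (-1) ^ k * ((-halfOmega r) ^ colExp k)⁻¹ := by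
  rw [DplusEntry, colExp]
  split_ifs with h0 h1 h1
  · omega
  · simp [h0]
  · have hodd : (-1 : ℂ) ^ k = -1 := (Nat.odd_iff.mpr h1).neg_one_pow
    obtain ⟨j, hj⟩ : ∃ j, (k + 1) / 2 = j + 1 := ⟨(k + 1) / 2 - 1, by omega⟩
    rw [exp_pi_mul_I_mul_div, _root_.zpow_neg, inv_inv, zpow_natCast, hodd, hj,
      neg_pow (halfOmega r), Nat.add_sub_cancel, pow_succ (-1 : ℂ)]
    ring
  · have heven : (-1 : ℂ) ^ k = 1 := (Nat.even_iff.mpr (by omega)).neg_one_pow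
    rw [Complex.exp_neg, exp_pi_mul_I_mul_div, zpow_natCast, neg_pow (halfOmega r), heven, mul_inv,
      ← inv_pow (-1 : ℂ)]
    norm_num

lemma DplusEntry_ne_zero (r k : ℕ) : DplusEntry r k ≠ 0 := by
  rw [DplusEntry_eq]
  exact mul_ne_zero (pow_ne_zero _ (by norm_num))
    (inv_ne_zero (zpow_ne_zero _ (neg_ne_zero.mpr (halfOmega_ne_zero r))))

lemma inv_DplusEntry (r k : ℕ) :
    (DplusEntry r k)⁻¹ = (-1) ^ k * (-halfOmega r) ^ colExp k := by
  rw [DplusEntry_eq, mul_inv, inv_inv, ← inv_pow]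
  norm_num

lemma inv_Dplus (r : ℕ) :
    (Dplus r)⁻¹ = Matrix.diagonal fun k : Fin r => (DplusEntry r k.val)⁻¹ := by
  refine Matrix.inv_eq_right_inv ?_
  rw [Dplus, Matrix.diagonal_mul_diagonal]
  simp [DplusEntry_ne_zero]

lemma sum_Omega_zpow {r : ℕ} (hr : 0 < r) (n : ℤ) :
    ∑ i : Fin r, Omega r ^ ((i.val : ℤ) * n) = if (r : ℤ) ∣ n then (r : ℂ) else 0 := by
  have hΩ := isPrimitiveRoot_Omega hr
  have hpow (i : ℕ) : Omega r ^ ((i : ℤ) * n) = (Omega r ^ n) ^ i := by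
    rw [mul_comm, _root_.zpow_mul, zpow_natCast]
  simp only [hpow]
  rw [Fin.sum_univ_eq_sum_range (fun i => (Omega r ^ n) ^ i) r]
  split_ifs with h
  · simp [(hΩ.zpow_eq_one_iff_dvd n).mpr h]
  · have hne : Omega r ^ n ≠ 1 := fun h' => h ((hΩ.zpow_eq_one_iff_dvd n).mp h')
    rw [geom_sum_eq hne, ← hpow, mul_comm, _root_.zpow_mul, zpow_natCast, ← zpow_natCast,
      ← _root_.zpow_mul, mul_comm, _root_.zpow_mul, zpow_natCast, hΩ.pow_eq_one]
    simp

lemma transpose_Uminus_mul_Lambda_mul_Uminus {r : ℕ} (hr : 0 < r) (a b : Fin r) :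
    ((Uminus r)ᵀ * Lambda r * Uminus r) a b =
      if (r : ℤ) ∣ colExp a.val + colExp b.val + 1 then 1 else 0 := by
  have hr' : (r : ℂ) ≠ 0 := by exact_mod_cast hr.ne'
  have hsq : (1 / (Real.sqrt r : ℂ)) * (1 / Real.sqrt r) = 1 / r := by
    rw [div_mul_div_comm, ← Complex.ofReal_mul, Real.mul_self_sqrt (Nat.cast_nonneg r)]
    simp
  have hterm (i : Fin r) : ((Uminus r)ᵀ * Lambda r) a i * Uminus r i b =
      1 / r * Omega r ^ ((i.val : ℤ) * (colExp a.val + colExp b.val + 1)) := by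
    rw [Lambda, Matrix.mul_diagonal, Matrix.transpose_apply, Uminus_apply, Uminus_apply, ← hsq,
      mul_add, mul_add, zpow_add₀ (Omega_ne_zero r), zpow_add₀ (Omega_ne_zero r), mul_one,
      zpow_natCast]
    ring
  rw [Matrix.mul_apply, Finset.sum_congr rfl fun i _ => hterm i, ← Finset.mul_sum,
    sum_Omega_zpow hr]
  split_ifs <;> simp [hr']

lemma dvd_colExp_add_iff {r a b : ℕ} (ha : a < r) (hb : b < r) :
    (r : ℤ) ∣ colExp a + colExp b + 1 ↔
      colExp a + colExp b + 1 = 0 ∨ colExp a + colExp b + 1 = r := by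
  have hlt : -(r : ℤ) < colExp a + colExp b + 1 ∧ colExp a + colExp b + 1 ≤ r := by
    unfold colExp
    split_ifs <;> omega
  constructor
  · rintro ⟨c, hc⟩
    have h1 : -1 < c := by nlinarith
    have h2 : c < 2 := by nlinarith
    obtain rfl | rfl : c = 0 ∨ c = 1 := by omega
    · simp [hc]
    · simp [hc]
  · rintro (h | h) <;> simp [h]

lemma colExp_add_eq_zero_iff (a b : ℕ) :
    colExp a + colExp b + 1 = 0 ↔
      (a % 2 = 0 ∧ b = a + 1) ∨ (a % 2 = 1 ∧ b + 1 = a) := by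
  unfold colExp
  split_ifs <;> omega

lemma colExp_add_eq_self_iff {r a b : ℕ} (ha : a < r) (hb : b < r) :
    colExp a + colExp b + 1 = r ↔ r % 2 = 1 ∧ a = r - 1 ∧ b = r - 1 := by
  unfold colExp
  split_ifs <;> omega

lemma neg_one_pow_mul_ite_eq_Kmat {r : ℕ} (hr : 0 < r) (a b : Fin r) :
    (-1) ^ a.val * (-halfOmega r) ^ (colExp a.val + colExp b.val + 1) *
      (if (r : ℤ) ∣ colExp a.val + colExp b.val + 1 then 1 else 0) = Kmat r a b := by
  have hdvd := dvd_colExp_add_iff a.isLt b.isLt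
  have hzero := colExp_add_eq_zero_iff a.val b.val
  have hself := colExp_add_eq_self_iff a.isLt b.isLt
  rw [Kmat]
  split_ifs with hd h1 h2 h3 h1 h2 h3
  · rw [hself.mpr h1, zpow_natCast, neg_pow (halfOmega r), halfOmega_pow_self hr,
      (Nat.even_iff.mpr (by omega : a.val % 2 = 0)).neg_one_pow,
      (Nat.odd_iff.mpr h1.1).neg_one_pow]
    norm_num
  · rw [hzero.mpr (Or.inl h2), (Nat.even_iff.mpr h2.1).neg_one_pow]
    simp
  · rw [hzero.mpr (Or.inr h3), (Nat.odd_iff.mpr h3.1).neg_one_pow]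
    simp
  · tauto
  · tauto
  · tauto
  · tauto
  · simp

/-- `(D⁺)⁻¹ · (U⁻)ᵀ · (−exp(πi/r)·Λ) · U⁻ · D⁻ = K`:
the jump of the RHP for `X` on `(−∞,0)`. -/
theorem jump_negative_axis (r : ℕ) (hr : 0 < r) :
    (Dplus r)⁻¹ * (Uminus r)ᵀ *
        ((-Complex.exp (Real.pi * Complex.I / r)) • Lambda r) *
        Uminus r * Dminus r = Kmat r := by
  ext a b
  have hassoc : (Dplus r)⁻¹ * (Uminus r)ᵀ * ((-Complex.exp (Real.pi * Complex.I / r)) • Lambda r) *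
      Uminus r * Dminus r =
      (-halfOmega r) • ((Dplus r)⁻¹ * ((Uminus r)ᵀ * Lambda r * Uminus r) * Dminus r) := by
    simp only [halfOmega, Matrix.mul_smul, Matrix.smul_mul, Matrix.mul_assoc]
  rw [hassoc, Matrix.smul_apply, inv_Dplus, Dminus, Matrix.mul_diagonal, Matrix.diagonal_mul,
    transpose_Uminus_mul_Lambda_mul_Uminus hr, inv_DplusEntry, DminusEntry_eq,
    ← neg_one_pow_mul_ite_eq_Kmat hr,
    zpow_add₀ (neg_ne_zero.mpr (halfOmega_ne_zero r)),
    zpow_add₀ (neg_ne_zero.mpr (halfOmega_ne_zero r)), zpow_one, smul_eq_mul]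
  ring
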